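/- Theorem (selections). Assume condition (exp). Then for all sufficiently large n there is a unique σ̃_n > 0 with M̃_n(σ̃_n) = n, and the number of selections satisfies c̃_n ∼ (e^{nσ̃_n} / √(2π B̃_n²)) · Π_{j=1}^n (1 + e^{−jσ̃_n})^{a_j} as n → ∞, where B̃_n² = Σ_{j=1}^n j² a_j e^{−jσ̃_n}/(1+e^{−jσ̃_n})². -/

import Mathlib

open Finset Filter

/-- The number of selections (multisets in which no component type appears more than once)
of total size `n` determined by the parameters `a j`:
`c̃_n = Σ_{η ∈ Ω_n} Π_{j=1}^n C(a_j, η_j)` where `Ω_n = {η : Σ_{j=1}^n j·η_j = n}`. -/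
def selectionCount (a : ℕ → ℕ) (n : ℕ) : ℕ :=
  ∑ η : Fin n → Fin (n + 1),
    if ∑ j : Fin n, (j.1 + 1) * (η j).1 = n then
      ∏ j : Fin n, Nat.choose (a (j.1 + 1)) (η j).1
    else 0

/-- `M̃_n(σ) = Σ_{j=1}^n j a_j e^{-jσ}/(1+e^{-jσ})`. -/
noncomputable def Mtilde (a : ℕ → ℕ) (n : ℕ) (σ : ℝ) : ℝ :=
  ∑ j ∈ Finset.Icc 1 n, (j : ℝ) * (a j) * Real.exp (-(j * σ)) / (1 + Real.exp (-(j * σ)))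

/-- `B̃_n²(σ) = Σ_{j=1}^n j² a_j e^{-jσ}/(1+e^{-jσ})²`. -/
noncomputable def B2tilde (a : ℕ → ℕ) (n : ℕ) (σ : ℝ) : ℝ :=
  ∑ j ∈ Finset.Icc 1 n, (j : ℝ) ^ 2 * (a j) * Real.exp (-(j * σ)) / (1 + Real.exp (-(j * σ))) ^ 2

/-- Condition (exp): `a_j ≍ j^{r-1} y^j`. -/
def ExpansiveCond (a : ℕ → ℕ) (r y : ℝ) : Prop :=
  ∃ D₁ D₂ : ℝ, 0 < D₁ ∧ 0 < D₂ ∧ ∀ j : ℕ, 1 ≤ j →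
    D₁ * (j : ℝ) ^ (r - 1) * y ^ j ≤ (a j : ℝ) ∧ (a j : ℝ) ≤ D₂ * (j : ℝ) ^ (r - 1) * y ^ j

/-! ### Coefficient extraction -/

open Polynomial in
lemma selectionCount_eq_coeff (a : ℕ → ℕ) (n : ℕ) :
    (∏ j ∈ Finset.Icc 1 n, (1 + (X : ℂ[X]) ^ j) ^ (a j)).coeff n = (selectionCount a n : ℂ) := by
  obtain ⟨m, hm⟩ : ∃ m : ℕ, n ≤ m ∧ ∀ j : Fin n, a (j.1 + 1) ≤ m := by
    refine ⟨n + ∑ j : Fin n, a (j.1 + 1), by omega, fun j => ?_⟩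
    have := Finset.single_le_sum (f := fun j : Fin n => a (j.1 + 1)) (fun _ _ => Nat.zero_le _)
      (Finset.mem_univ j)
    omega
  have h1 : ∏ j ∈ Finset.Icc 1 n, (1 + (X : ℂ[X]) ^ j) ^ (a j)
      = ∏ j : Fin n, (1 + (X : ℂ[X]) ^ (j.1 + 1)) ^ (a (j.1 + 1)) := by
    rw [Fin.prod_univ_eq_prod_range (fun j => (1 + (X : ℂ[X]) ^ (j + 1)) ^ (a (j + 1))) n,
      Finset.range_eq_Ico, Finset.prod_Ico_add' (fun j => (1 + (X : ℂ[X]) ^ j) ^ (a j)) 0 n 1]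
    rfl
  have h2 : ∀ j : Fin n, (1 + (X : ℂ[X]) ^ (j.1 + 1)) ^ (a (j.1 + 1))
      = ∑ k ∈ Finset.range (m + 1), C ((Nat.choose (a (j.1 + 1)) k : ℕ) : ℂ) * X ^ ((j.1 + 1) * k) := by
    intro j
    rw [add_comm, add_pow]
    have : Finset.range (a (j.1 + 1) + 1) ⊆ Finset.range (m + 1) := by
      have := hm.2 j
      intro x hx
      simp only [Finset.mem_range] at hx ⊢
      omega
    rw [← Finset.sum_subset this]
    · refine Finset.sum_congr rfl fun k _ => ?_
      rw [← pow_mul, one_pow, mul_one, mul_comm]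
      simp
    · intro k _ hk
      simp only [Finset.mem_range, not_lt] at hk
      rw [Nat.choose_eq_zero_of_lt (by omega)]
      simp
  rw [h1, Finset.prod_congr rfl (fun j _ => h2 j), Finset.prod_univ_sum]
  rw [finsetSum_coeff]
  have h3 : ∀ p : Fin n → ℕ, (∏ j : Fin n, (C ((Nat.choose (a (j.1 + 1)) (p j) : ℕ) : ℂ)
      * (X : ℂ[X]) ^ ((j.1 + 1) * p j))).coeff n
      = ((if ∑ j : Fin n, (j.1 + 1) * p j = n then
        ∏ j : Fin n, Nat.choose (a (j.1 + 1)) (p j) else 0 : ℕ) : ℂ) := by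
    intro p
    rw [Finset.prod_mul_distrib, Finset.prod_pow_eq_pow_sum, ← map_prod, coeff_C_mul, coeff_X_pow]
    split_ifs with h h' h'
    · push_cast; ring
    · exact absurd h.symm h'
    · exact absurd h'.symm h
    · simp
  simp_rw [h3]
  rw [← Nat.cast_sum]
  congr 1
  unfold selectionCount
  have h4 : Fintype.piFinset (fun _ : Fin n => Finset.range (n + 1))
      ⊆ Fintype.piFinset (fun _ : Fin n => Finset.range (m + 1)) := by
    refine Fintype.piFinset_subset _ _ fun _ x hx => ?_
    simp only [Finset.mem_range] at hx ⊢
    omega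
  rw [← Finset.sum_subset h4]
  · symm
    refine Finset.sum_bij (fun η _ j => (η j).1) ?_ ?_ ?_ ?_
    · intro η _
      simp only [Fintype.mem_piFinset, Finset.mem_range]
      intro j
      exact (η j).2
    · intro η _ η' _ h
      funext j
      exact Fin.ext (congrFun h j)
    · intro p hp
      simp only [Fintype.mem_piFinset, Finset.mem_range] at hp
      exact ⟨fun j => ⟨p j, hp j⟩, Finset.mem_univ _, rfl⟩
    · intro η _
      rfl
  · intro p _ hp
    rw [if_neg]
    intro hs
    apply hp
    simp only [Fintype.mem_piFinset, Finset.mem_range]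
    intro j
    have := Finset.single_le_sum (f := fun j : Fin n => (j.1 + 1) * p j)
      (fun _ _ => Nat.zero_le _) (Finset.mem_univ j)
    nlinarith

/-- The characteristic function of the recentred random sum. -/
noncomputable def PhiSel (a : ℕ → ℕ) (n : ℕ) (σ t : ℝ) : ℂ :=
  (∏ j ∈ Finset.Icc 1 n,
    ((1 + (Real.exp (-(j * σ)) : ℂ) * Complex.exp (Complex.I * (j * t : ℝ))) /
      (1 + (Real.exp (-(j * σ)) : ℂ))) ^ (a j)) * Complex.exp (-(Complex.I * (n * t : ℝ)))

lemma integral_exp_int (m : ℤ) :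
    ∫ t in (-Real.pi)..Real.pi, Complex.exp (Complex.I * m * t)
      = if m = 0 then (2 * Real.pi : ℂ) else 0 := by
  split_ifs with h
  · subst h
    simp
    ring
  · have hm : Complex.I * (m : ℂ) ≠ 0 := by simp [h]
    rw [integral_exp_mul_complex hm]
    have : Complex.exp (Complex.I * m * (Real.pi : ℝ)) = Complex.exp (Complex.I * m * ((-Real.pi : ℝ) : ℂ)) := by
      rw [Complex.exp_eq_exp_iff_exists_int]
      refine ⟨m, ?_⟩
      push_cast
      ring
    rw [this]
    simp

open Polynomial in
lemma integral_PhiSel (a : ℕ → ℕ) (n : ℕ) (σ : ℝ) :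
    ∫ t in (-Real.pi)..Real.pi, PhiSel a n σ t
      = ((2 * Real.pi * ((selectionCount a n : ℝ) /
          (Real.exp (n * σ) * ∏ j ∈ Finset.Icc 1 n, (1 + Real.exp (-(j * σ))) ^ (a j))) : ℝ) : ℂ) := by
  set P : ℂ[X] := ∏ j ∈ Finset.Icc 1 n, (1 + (X : ℂ[X]) ^ j) ^ (a j) with hP
  set D : ℂ := ∏ j ∈ Finset.Icc 1 n, (1 + (Real.exp (-(j * σ)) : ℂ)) ^ (a j) with hD
  have h1 : ∀ t : ℝ, PhiSel a n σ t = ∑ k ∈ Finset.range (P.natDegree + 1 + n),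
      (P.coeff k * Complex.exp (-(k * σ)) / D) * Complex.exp (Complex.I * ((k : ℤ) - (n : ℤ) : ℤ) * t) := by
    intro t
    have he : (∏ j ∈ Finset.Icc 1 n,
        ((1 + (Real.exp (-(j * σ)) : ℂ) * Complex.exp (Complex.I * (j * t : ℝ)))) ^ (a j))
        = P.eval (Complex.exp (-σ + Complex.I * t)) := by
      rw [hP, eval_prod]
      refine Finset.prod_congr rfl fun j _ => ?_
      simp only [eval_pow, eval_add, eval_one, eval_X]
      rw [← Complex.exp_nat_mul, Complex.ofReal_exp, ← Complex.exp_add]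
      congr 3
      push_cast
      ring_nf
    unfold PhiSel
    simp_rw [div_pow]
    rw [Finset.prod_div_distrib, he, ← hD, eval_eq_sum_range' (n := P.natDegree + 1 + n) (by omega)]
    rw [Finset.sum_div, Finset.sum_mul]
    refine Finset.sum_congr rfl fun k _ => ?_
    rw [← Complex.exp_nat_mul]
    have : Complex.exp (k * (-σ + Complex.I * t)) * Complex.exp (-(Complex.I * ((n * t : ℝ) : ℂ)))
       = Complex.exp (-(k * σ)) * Complex.exp (Complex.I * ((k : ℤ) - (n : ℤ) : ℤ) * t) := by
      rw [← Complex.exp_add, ← Complex.exp_add]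
      congr 1
      push_cast
      ring
    calc _ = P.coeff k / D * (Complex.exp (k * (-σ + Complex.I * t)) * Complex.exp (-(Complex.I * ((n * t : ℝ) : ℂ)))) := by ring
      _ = _ := by rw [this]; ring
  simp_rw [h1]
  rw [intervalIntegral.integral_finsetSum]
  · simp_rw [intervalIntegral.integral_const_mul, integral_exp_int]
    rw [Finset.sum_eq_single n]
    · rw [hP, selectionCount_eq_coeff]
      simp only [sub_self, if_true]
      rw [Complex.exp_neg, hD]
      push_cast
      field_simp
    · intro k _ hk
      rw [if_neg (by omega)]
      simp
    · intro h
      exact absurd (Finset.mem_range.2 (by omega)) h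
  · intro k _
    apply Continuous.intervalIntegrable
    fun_prop

/-! ### Local estimates of the characteristic function -/

lemma norm_taylor_exp (x : ℝ) :
    ‖Complex.exp (Complex.I * x) - (1 + Complex.I * x - x ^ 2 / 2)‖ ≤ 4 * |x| ^ 3 := by
  have hI : ‖Complex.I * (x : ℂ)‖ = |x| := by simp
  rcases le_total |x| 1 with h | h
  · have := Complex.exp_bound (x := Complex.I * x) (by rw [hI]; exact h) (n := 3) (by norm_num)
    rw [hI] at this
    have e : ∑ m ∈ Finset.range 3, (Complex.I * (x : ℂ)) ^ m / (m.factorial : ℂ)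
        = 1 + Complex.I * x - x ^ 2 / 2 := by
      simp [Finset.sum_range_succ, mul_pow, Nat.factorial]
      ring
    rw [e] at this
    refine this.trans ?_
    rw [mul_comm]
    gcongr
    norm_num [Nat.factorial]
  · have h1 : ‖Complex.exp (Complex.I * x)‖ = 1 := by
      rw [mul_comm, Complex.norm_exp_ofReal_mul_I]
    have h2 : ‖(1 + Complex.I * x - x ^ 2 / 2 : ℂ)‖ ≤ 1 + |x| + |x| ^ 2 / 2 := by
      refine (norm_sub_le _ _).trans ?_
      refine add_le_add ((norm_add_le _ _).trans ?_) ?_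
      · simp
      · simp
    refine (norm_sub_le _ _).trans ?_
    rw [h1]
    have h3 : |x| ≤ |x| ^ 2 := by nlinarith
    have h4 : |x| ^ 2 ≤ |x| ^ 3 := by nlinarith [sq_nonneg |x|]
    nlinarith

lemma norm_prod_pow_sub_le (s : Finset ℕ) (a : ℕ → ℕ) (z w : ℕ → ℂ)
    (hz : ∀ j ∈ s, ‖z j‖ ≤ 1) (hw : ∀ j ∈ s, ‖w j‖ ≤ 1) :
    ‖∏ j ∈ s, z j ^ a j - ∏ j ∈ s, w j ^ a j‖ ≤ ∑ j ∈ s, a j * ‖z j - w j‖ := by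
  have hpow : ∀ (u v : ℂ) (m : ℕ), ‖u‖ ≤ 1 → ‖v‖ ≤ 1 → ‖u ^ m - v ^ m‖ ≤ m * ‖u - v‖ := by
    intro u v m hu hv
    induction m with
    | zero => simp
    | succ m ih =>
      have : u ^ (m + 1) - v ^ (m + 1) = u ^ m * (u - v) + (u ^ m - v ^ m) * v := by ring
      rw [this]
      refine (norm_add_le _ _).trans ?_
      rw [norm_mul, norm_mul, norm_pow]
      have h1 : ‖u‖ ^ m ≤ 1 := pow_le_one₀ (norm_nonneg _) hu
      push_cast
      nlinarith [norm_nonneg (u - v), norm_nonneg (u ^ m - v ^ m), norm_nonneg v]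
  induction s using Finset.induction_on with
  | empty => simp
  | insert i s hi ih =>
    rw [Finset.prod_insert hi, Finset.prod_insert hi, Finset.sum_insert hi]
    have ih' := ih (fun j hj => hz j (Finset.mem_insert_of_mem hj))
      (fun j hj => hw j (Finset.mem_insert_of_mem hj))
    have hi1 := hz i (Finset.mem_insert_self _ _)
    have hi2 := hw i (Finset.mem_insert_self _ _)
    have hp := hpow _ _ (a i) hi1 hi2
    have hP : ‖∏ j ∈ s, w j ^ a j‖ ≤ 1 := by
      rw [norm_prod]
      refine Finset.prod_le_one (fun _ _ => norm_nonneg _) fun j hj => ?_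
      rw [norm_pow]
      exact pow_le_one₀ (norm_nonneg _) (hw j (Finset.mem_insert_of_mem hj))
    have hQ : ‖z i ^ a i‖ ≤ 1 := by
      rw [norm_pow]
      exact pow_le_one₀ (norm_nonneg _) hi1
    have : z i ^ a i * ∏ j ∈ s, z j ^ a j - w i ^ a i * ∏ j ∈ s, w j ^ a j
      = z i ^ a i * (∏ j ∈ s, z j ^ a j - ∏ j ∈ s, w j ^ a j)
        + (z i ^ a i - w i ^ a i) * ∏ j ∈ s, w j ^ a j := by ring
    rw [this]
    refine (norm_add_le _ _).trans ?_
    rw [norm_mul, norm_mul]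
    nlinarith [norm_nonneg (∏ j ∈ s, z j ^ a j - ∏ j ∈ s, w j ^ a j),
      norm_nonneg (z i ^ a i - w i ^ a i), norm_nonneg (∏ j ∈ s, w j ^ a j)]

/-- one-factor modulus -/
lemma norm_factor_le (w x : ℝ) (hw : 0 < w) :
    ‖(1 + (w : ℂ) * Complex.exp (Complex.I * x)) / (1 + (w : ℂ))‖
      ≤ Real.exp (-(w / (1 + w) ^ 2 * (1 - Real.cos x))) := by
  have h1 : ‖(1 + (w : ℂ) * Complex.exp (Complex.I * x)) / (1 + (w : ℂ))‖ ^ 2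
      = 1 - 2 * (w / (1 + w) ^ 2 * (1 - Real.cos x)) := by
    rw [norm_div, div_pow]
    have e1 : ‖(1 + (w : ℂ))‖ = 1 + w := by
      rw [show (1 + (w : ℂ)) = ((1 + w : ℝ) : ℂ) by push_cast; ring, Complex.norm_real,
        Real.norm_of_nonneg (by positivity)]
    have e2 : ‖1 + (w : ℂ) * Complex.exp (Complex.I * x)‖ ^ 2 = 1 + 2 * w * Real.cos x + w ^ 2 := by
      rw [← Complex.normSq_eq_norm_sq, mul_comm Complex.I, Complex.exp_mul_I, Complex.normSq_apply]
      simp [← Complex.ofReal_cos, ← Complex.ofReal_sin]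
      nlinarith [Real.sin_sq_add_cos_sq x]
    rw [e1, e2]
    field_simp
    ring
  have h2 := Real.add_one_le_exp (-(2 * (w / (1 + w) ^ 2 * (1 - Real.cos x))))
  have h3 : Real.exp (-(2 * (w / (1 + w) ^ 2 * (1 - Real.cos x))))
    = Real.exp (-(w / (1 + w) ^ 2 * (1 - Real.cos x))) ^ 2 := by
    rw [← Real.exp_nat_mul]; congr 1; push_cast; ring
  refine le_of_sq_le_sq ?_ (Real.exp_pos _).le
  rw [h1, ← h3]
  linarith

lemma norm_PhiSel_le (a : ℕ → ℕ) (n : ℕ) (σ t : ℝ) :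
    ‖PhiSel a n σ t‖ ≤ Real.exp (-∑ j ∈ Finset.Icc 1 n,
      (a j) * (Real.exp (-(j * σ)) / (1 + Real.exp (-(j * σ))) ^ 2) * (1 - Real.cos (j * t))) := by
  unfold PhiSel
  rw [norm_mul]
  have : ‖Complex.exp (-(Complex.I * (n * t : ℝ)))‖ = 1 := by
    rw [show -(Complex.I * ((n * t : ℝ) : ℂ)) = ((-(n * t) : ℝ) : ℂ) * Complex.I by push_cast; ring,
      Complex.norm_exp_ofReal_mul_I]
  rw [this, mul_one, norm_prod, ← Finset.sum_neg_distrib, Real.exp_sum]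
  refine Finset.prod_le_prod (fun _ _ => norm_nonneg _) fun j _ => ?_
  rw [norm_pow]
  have h := norm_factor_le (Real.exp (-(j * σ))) (j * t) (Real.exp_pos _)
  refine (pow_le_pow_left₀ (norm_nonneg _) h _).trans (le_of_eq ?_)
  rw [← Real.exp_nat_mul]
  congr 1
  ring

/-- one-factor expansion -/
lemma norm_factor_sub_le (w x : ℝ) (hw : 0 < w) :
    ‖(1 + (w : ℂ) * Complex.exp (Complex.I * x)) / (1 + (w : ℂ))
        * Complex.exp (-(Complex.I * (x * (w / (1 + w)) : ℝ)))
      - Complex.exp (-(w / (1 + w) ^ 2 * x ^ 2 / 2 : ℝ))‖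
      ≤ w / (1 + w) ^ 2 * (4 * |x| ^ 3 + |x| ^ 4) := by
  set p : ℝ := w / (1 + w) with hp
  have hp0 : 0 < p := by positivity
  have hp1 : 0 < 1 - p := by
    have : 1 - p = 1 / (1 + w) := by rw [hp]; field_simp; ring
    rw [this]; positivity
  have hq : w / (1 + w) ^ 2 = p * (1 - p) := by rw [hp]; field_simp; ring
  rw [hq]
  have hwc : (1 + (w : ℂ)) ≠ 0 := by
    rw [show (1 + (w : ℂ)) = ((1 + w : ℝ) : ℂ) by push_cast; ring]
    exact_mod_cast (by positivity : (1 + w) ≠ 0)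
  have hf : (1 + (w : ℂ) * Complex.exp (Complex.I * x)) / (1 + (w : ℂ))
        * Complex.exp (-(Complex.I * (x * p : ℝ)))
      = (1 - p) * Complex.exp (Complex.I * ((-(x * p) : ℝ) : ℂ))
        + p * Complex.exp (Complex.I * ((x * (1 - p) : ℝ) : ℂ)) := by
    have e1 : (1 + (w : ℂ) * Complex.exp (Complex.I * x)) / (1 + (w : ℂ))
        = (1 - p) + p * Complex.exp (Complex.I * x) := by
      rw [hp]; push_cast; field_simp; ring
    rw [e1, add_mul, mul_assoc, ← Complex.exp_add]
    congr 3 <;> push_cast <;> ring_nf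
  rw [hf]
  set T : ℝ → ℂ := fun u => Complex.exp (Complex.I * u) - (1 + Complex.I * u - u ^ 2 / 2) with hT
  have hTb : ∀ u, ‖T u‖ ≤ 4 * |u| ^ 3 := norm_taylor_exp
  set u : ℝ := p * (1 - p) * x ^ 2 / 2 with hu
  have hu0 : 0 ≤ u := by positivity
  have key : (1 - p) * Complex.exp (Complex.I * ((-(x * p) : ℝ) : ℂ))
        + p * Complex.exp (Complex.I * ((x * (1 - p) : ℝ) : ℂ)) - Complex.exp (-(u : ℂ))
      = ((1 - p : ℝ) : ℂ) * T (-(x * p)) + (p : ℂ) * T (x * (1 - p)) - ((Real.exp (-u) - (1 - u) : ℝ) : ℂ) := by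
    simp only [hT, hu]
    push_cast
    ring
  rw [key]
  have hE : |Real.exp (-u) - (1 - u)| ≤ u ^ 2 := by
    rw [abs_of_nonneg (by linarith [Real.add_one_le_exp (-u)])]
    have h1 : Real.exp (-u) ≤ 1 / (1 + u) := by
      rw [Real.exp_neg, ← one_div]
      apply one_div_le_one_div_of_le (by positivity)
      linarith [Real.add_one_le_exp u]
    have h2 : 1 / (1 + u) ≤ 1 - u + u ^ 2 := by
      rw [div_le_iff₀ (by positivity)]
      nlinarith [pow_nonneg hu0 3]
    linarith
  have hpq : p * (1 - p) ≤ 1 := by nlinarith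
  have hx3 : 0 ≤ |x| ^ 3 := by positivity
  have hx4 : x ^ 4 = |x| ^ 4 := by
    rw [show |x| ^ 4 = (|x| ^ 2) ^ 2 by ring, sq_abs]; ring
  calc _ ≤ (1 - p) * (4 * (|x| * p) ^ 3) + p * (4 * (|x| * (1 - p)) ^ 3) + u ^ 2 := by
        refine (norm_sub_le _ _).trans (add_le_add ((norm_add_le _ _).trans (add_le_add ?_ ?_)) ?_)
        · rw [norm_mul, Complex.norm_real, Real.norm_of_nonneg hp1.le]
          have := hTb (-(x * p))
          rw [abs_neg, abs_mul, abs_of_pos hp0] at this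
          gcongr
        · rw [norm_mul, Complex.norm_real, Real.norm_of_nonneg hp0.le]
          have := hTb (x * (1 - p))
          rw [abs_mul, abs_of_pos hp1] at this
          gcongr
        · rw [Complex.norm_real]; exact hE
    _ = p * (1 - p) * (4 * |x| ^ 3 * (p ^ 2 + (1 - p) ^ 2)) + p * (1 - p) * ((p * (1 - p)) / 4 * |x| ^ 4) := by
        rw [← hx4, hu]; ring
    _ ≤ p * (1 - p) * (4 * |x| ^ 3 * 1) + p * (1 - p) * (1 * |x| ^ 4) := by
        have : p ^ 2 + (1 - p) ^ 2 ≤ 1 := by nlinarith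
        gcongr
        linarith
    _ = _ := by ring

lemma norm_PhiSel_sub_le (a : ℕ → ℕ) (n : ℕ) (σ t : ℝ) (hM : Mtilde a n σ = n) :
    ‖PhiSel a n σ t - Complex.exp ((-(B2tilde a n σ * t ^ 2 / 2) : ℝ) : ℂ)‖ ≤
      ∑ j ∈ Finset.Icc 1 n, (a j) * (Real.exp (-(j * σ)) / (1 + Real.exp (-(j * σ))) ^ 2
        * (4 * |j * t| ^ 3 + |j * t| ^ 4)) := by
  set w : ℕ → ℝ := fun j => Real.exp (-(j * σ)) with hw
  have hw0 : ∀ j, 0 < w j := fun j => Real.exp_pos _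
  have h1 : PhiSel a n σ t = ∏ j ∈ Finset.Icc 1 n,
      ((1 + (w j : ℂ) * Complex.exp (Complex.I * (j * t : ℝ))) / (1 + (w j : ℂ))
        * Complex.exp (-(Complex.I * ((j * t) * (w j / (1 + w j)) : ℝ)))) ^ (a j) := by
    simp_rw [mul_pow]
    rw [Finset.prod_mul_distrib]
    unfold PhiSel
    congr 1
    simp_rw [← Complex.exp_nat_mul]
    rw [← Complex.exp_sum]
    congr 1
    have : ((n * t : ℝ) : ℂ) = ((Mtilde a n σ * t : ℝ) : ℂ) := by rw [hM]
    rw [this]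
    unfold Mtilde
    rw [Finset.sum_mul]
    push_cast
    rw [Finset.mul_sum, ← Finset.sum_neg_distrib]
    refine Finset.sum_congr rfl fun j _ => ?_
    simp only [hw]
    push_cast
    ring
  have h2 : Complex.exp ((-(B2tilde a n σ * t ^ 2 / 2) : ℝ) : ℂ) = ∏ j ∈ Finset.Icc 1 n,
      (Complex.exp (-(w j / (1 + w j) ^ 2 * (j * t) ^ 2 / 2 : ℝ))) ^ (a j) := by
    simp_rw [← Complex.exp_nat_mul]
    rw [← Complex.exp_sum]
    congr 1
    unfold B2tilde
    rw [Finset.sum_mul, Finset.sum_div]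
    push_cast
    rw [← Finset.sum_neg_distrib]
    refine Finset.sum_congr rfl fun j _ => ?_
    simp only [hw]
    push_cast
    ring
  rw [h1, h2]
  refine (norm_prod_pow_sub_le _ _ _ _ ?_ ?_).trans ?_
  · intro j _
    rw [norm_mul]
    have : ‖Complex.exp (-(Complex.I * ((j * t) * (w j / (1 + w j)) : ℝ)))‖ = 1 := by
      rw [show -(Complex.I * (((j * t) * (w j / (1 + w j)) : ℝ) : ℂ))
        = ((-((j * t) * (w j / (1 + w j))) : ℝ) : ℂ) * Complex.I by push_cast; ring,
        Complex.norm_exp_ofReal_mul_I]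
    rw [this, mul_one]
    refine (norm_factor_le _ _ (hw0 j)).trans ?_
    rw [Real.exp_le_one_iff]
    have : 0 ≤ 1 - Real.cos (j * t) := by linarith [Real.cos_le_one (j * t)]
    have := hw0 j
    simp only [Left.neg_nonpos_iff]
    positivity
  · intro j _
    rw [← Complex.ofReal_neg, ← Complex.ofReal_exp, Complex.norm_real, Real.norm_of_nonneg (Real.exp_pos _).le,
      Real.exp_le_one_iff]
    have := hw0 j
    simp only [Left.neg_nonpos_iff]
    positivity
  · refine Finset.sum_le_sum fun j _ => ?_
    gcongr
    exact norm_factor_sub_le _ _ (hw0 j)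

/-! ### Growth estimates -/

lemma sum_exp_le (x : ℝ) (hx : 0 < x) (n : ℕ) :
    ∑ j ∈ Finset.Icc 1 n, Real.exp (-(j * x)) ≤ 1 / x := by
  have h : x * ∑ j ∈ Finset.Icc 1 n, Real.exp (-(j * x)) ≤ 1 - Real.exp (-(n * x)) := by
    induction n with
    | zero => simp
    | succ n ih =>
      rw [Finset.sum_Icc_succ_top (by omega), mul_add]
      have e : Real.exp (-(n * x)) = Real.exp (-(((n + 1 : ℕ) : ℝ) * x)) * Real.exp x := by
        rw [← Real.exp_add]; congr 1; push_cast; ring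
      have h1 := Real.add_one_le_exp x
      have h2 := Real.exp_pos (-(((n + 1 : ℕ) : ℝ) * x))
      nlinarith
  rw [le_div_iff₀ hx]
  linarith [Real.exp_pos (-(n * x))]

lemma sum_upper (s : ℝ) (hs : 0 < s) : ∃ C > 0, ∀ δ : ℝ, 0 < δ → ∀ n : ℕ,
    ∑ j ∈ Finset.Icc 1 n, (j : ℝ) ^ s * Real.exp (-(j * δ)) ≤ C * δ ^ (-(s + 1)) := by
  refine ⟨2 * (2 * s) ^ s, by positivity, fun δ hδ n => ?_⟩
  have key : ∀ x : ℝ, 0 < x → x ^ s ≤ (2 * s) ^ s * Real.exp (x / 2) := by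
    intro x hx
    have h1 : x ≤ 2 * s * Real.exp (x / (2 * s)) := by
      have := Real.add_one_le_exp (x / (2 * s))
      have h2 : x / (2 * s) ≤ Real.exp (x / (2 * s)) := by linarith
      rw [div_le_iff₀ (by positivity)] at h2
      linarith
    calc x ^ s ≤ (2 * s * Real.exp (x / (2 * s))) ^ s := Real.rpow_le_rpow hx.le h1 hs.le
      _ = _ := by
        rw [Real.mul_rpow (by positivity) (Real.exp_pos _).le, ← Real.exp_mul]
        congr 2
        field_simp
  calc ∑ j ∈ Finset.Icc 1 n, (j : ℝ) ^ s * Real.exp (-(j * δ))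
      ≤ ∑ j ∈ Finset.Icc 1 n, (δ ^ (-s) * (2 * s) ^ s) * Real.exp (-(j * (δ / 2))) := by
        refine Finset.sum_le_sum fun j hj => ?_
        have hj1 : 1 ≤ j := (Finset.mem_Icc.1 hj).1
        have hj0 : (0 : ℝ) < j := by exact_mod_cast hj1
        have h := key (j * δ) (by positivity)
        rw [Real.mul_rpow hj0.le hδ.le] at h
        have e : Real.exp (-(j * δ)) = Real.exp (-(j * (δ / 2))) * Real.exp (-(j * (δ / 2))) := by
          rw [← Real.exp_add]; congr 1; ring
        have e2 : Real.exp (j * δ / 2) * Real.exp (-(j * (δ / 2))) = 1 := by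
          rw [← Real.exp_add, ← Real.exp_zero]; congr 1; ring
        have hd : δ ^ (-s) * δ ^ s = 1 := by
          rw [← Real.rpow_add hδ]; simp
        have hd0 : 0 < δ ^ (-s) := by positivity
        calc (j : ℝ) ^ s * Real.exp (-(j * δ))
            = δ ^ (-s) * ((j : ℝ) ^ s * δ ^ s) * Real.exp (-(j * (δ / 2))) * Real.exp (-(j * (δ / 2))) := by
              rw [e]; linear_combination (-(j : ℝ) ^ s * Real.exp (-(j * (δ / 2))) * Real.exp (-(j * (δ / 2)))) * hd
          _ ≤ δ ^ (-s) * ((2 * s) ^ s * Real.exp (j * δ / 2)) * Real.exp (-(j * (δ / 2))) * Real.exp (-(j * (δ / 2))) := by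
              gcongr
          _ = _ := by linear_combination (δ ^ (-s) * (2 * s) ^ s * Real.exp (-(j * (δ / 2)))) * e2
    _ ≤ (δ ^ (-s) * (2 * s) ^ s) * (1 / (δ / 2)) := by
        rw [← Finset.mul_sum]
        gcongr
        exact sum_exp_le _ (by positivity) _
    _ = _ := by
        rw [neg_add, Real.rpow_add hδ, Real.rpow_neg_one]
        field_simp

lemma sum_cos_le (t : ℝ) (m N : ℕ) :
    |Real.sin (t / 2)| * ∑ j ∈ Finset.Ioc m (m + N), Real.cos (j * t) ≤ 1 := by
  have h : 2 * Real.sin (t / 2) * ∑ j ∈ Finset.Ioc m (m + N), Real.cos (j * t)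
      = Real.sin ((((m + N : ℕ) : ℝ) + 1 / 2) * t) - Real.sin (((m : ℝ) + 1 / 2) * t) := by
    induction N with
    | zero => simp
    | succ N ih =>
      rw [← add_assoc, Finset.sum_Ioc_succ_top (by omega), mul_add, ih]
      have e1 : (((m + N + 1 : ℕ) : ℝ) + 1 / 2) * t = ((m + N + 1 : ℕ) : ℝ) * t + t / 2 := by ring
      have e2 : (((m + N : ℕ) : ℝ) + 1 / 2) * t = ((m + N + 1 : ℕ) : ℝ) * t - t / 2 := by
        push_cast; ring
      rw [e1, e2, Real.sin_add, Real.sin_sub]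
      ring
  have h2 : |2 * Real.sin (t / 2) * ∑ j ∈ Finset.Ioc m (m + N), Real.cos (j * t)| ≤ 2 := by
    rw [h, abs_le]
    constructor <;> linarith [Real.sin_le_one ((((m + N : ℕ) : ℝ) + 1 / 2) * t),
      Real.neg_one_le_sin ((((m + N : ℕ) : ℝ) + 1 / 2) * t), Real.sin_le_one (((m : ℝ) + 1 / 2) * t),
      Real.neg_one_le_sin (((m : ℝ) + 1 / 2) * t)]
  rw [abs_mul, abs_mul, abs_two] at h2
  have h3 := le_abs_self (∑ j ∈ Finset.Ioc m (m + N), Real.cos (j * t))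
  have h4 := abs_nonneg (Real.sin (t / 2))
  nlinarith

lemma weight_low (c r δ : ℝ) (hc : 0 < c) (hr : 0 < r) (K : ℕ) (hK : 1 ≤ K)
    (hδK : δ * (8 * K) ≤ 1) (hδ : 0 < δ) (j : ℕ) (h1 : K ≤ j) (h2 : j ≤ 16 * K) :
    c * (Real.exp (-2) / 16) * ((K : ℝ) ^ r / K) ≤ c * (j : ℝ) ^ (r - 1) * Real.exp (-(j * δ)) := by
  have hK0 : (0 : ℝ) < K := by exact_mod_cast hK
  have h1' : (K : ℝ) ≤ j := by exact_mod_cast h1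
  have h2' : (j : ℝ) ≤ 16 * K := by exact_mod_cast h2
  have hj0 : (0 : ℝ) < j := by linarith
  have e1 : (j : ℝ) ^ (r - 1) = (j : ℝ) ^ r / j := by rw [Real.rpow_sub_one hj0.ne']
  have e2 : Real.exp (-2) ≤ Real.exp (-(j * δ)) := by
    apply Real.exp_le_exp.2
    nlinarith
  have e3 : (K : ℝ) ^ r / (16 * K) ≤ (j : ℝ) ^ r / j := by
    gcongr
  rw [e1]
  calc _ = c * ((K : ℝ) ^ r / (16 * K)) * Real.exp (-2) := by field_simp
    _ ≤ _ := by gcongr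

lemma V_low_small (A : ℕ → ℝ) (c r δ : ℝ) (hc : 0 < c) (hr : 0 < r) (K n : ℕ) (hK : 1 ≤ K)
    (hKn : 16 * K ≤ n) (hδK : δ * (8 * K) ≤ 1) (hδ : 0 < δ)
    (hA : ∀ j : ℕ, 1 ≤ j → c * (j : ℝ) ^ (r - 1) * Real.exp (-(j * δ)) ≤ A j)
    (t : ℝ) (ht : |t| ≤ Real.pi / (4 * K)) :
    c * (Real.exp (-2) / 16) * (2 / Real.pi ^ 2) * ((K : ℝ) ^ r * (K : ℝ) ^ 2) * t ^ 2 ≤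
      ∑ j ∈ Finset.Icc 1 n, A j * (1 - Real.cos (j * t)) := by
  have hK0 : (0 : ℝ) < K := by exact_mod_cast hK
  have hA0 : ∀ j : ℕ, 1 ≤ j → 0 ≤ A j := fun j hj => le_trans (by positivity) (hA j hj)
  have hsub : Finset.Ioc K (2 * K) ⊆ Finset.Icc 1 n := by
    intro j hj
    simp only [Finset.mem_Ioc, Finset.mem_Icc] at hj ⊢
    omega
  have h1 : ∑ j ∈ Finset.Ioc K (2 * K), A j * (1 - Real.cos (j * t)) ≤
      ∑ j ∈ Finset.Icc 1 n, A j * (1 - Real.cos (j * t)) := by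
    refine Finset.sum_le_sum_of_subset_of_nonneg hsub fun j hj _ => ?_
    have := hA0 j (Finset.mem_Icc.1 hj).1
    have : 0 ≤ 1 - Real.cos (j * t) := by linarith [Real.cos_le_one (j * t)]
    positivity
  refine le_trans ?_ h1
  have h2 : ∑ j ∈ Finset.Ioc K (2 * K), (c * (Real.exp (-2) / 16) * ((K : ℝ) ^ r / K)) *
      (2 / Real.pi ^ 2 * (K * t) ^ 2) ≤ ∑ j ∈ Finset.Ioc K (2 * K), A j * (1 - Real.cos (j * t)) := by
    refine Finset.sum_le_sum fun j hj => ?_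
    rw [Finset.mem_Ioc] at hj
    have h1' : (K : ℝ) ≤ j := by exact_mod_cast hj.1.le
    have h2' : (j : ℝ) ≤ 2 * K := by exact_mod_cast hj.2
    have hw := (weight_low c r δ hc hr K hK hδK hδ j hj.1.le (by omega)).trans (hA j (by omega))
    have hcos : 2 / Real.pi ^ 2 * (K * t) ^ 2 ≤ 1 - Real.cos (j * t) := by
      have hjt : |j * t| ≤ Real.pi := by
        rw [abs_mul, abs_of_nonneg (by positivity : (0 : ℝ) ≤ j)]
        calc (j : ℝ) * |t| ≤ 2 * K * (Real.pi / (4 * K)) := by gcongr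
          _ = Real.pi / 2 := by field_simp; norm_num
          _ ≤ Real.pi := by linarith [Real.pi_pos]
      have := Real.cos_le_one_sub_mul_cos_sq hjt
      have h3 : (K * t) ^ 2 ≤ (j * t) ^ 2 := by
        rw [mul_pow, mul_pow]; gcongr
      have h4 : 2 / Real.pi ^ 2 * (K * t) ^ 2 ≤ 2 / Real.pi ^ 2 * (j * t) ^ 2 := by gcongr
      linarith
    have := hA0 j (by omega)
    gcongr
  refine le_trans (le_of_eq ?_) h2
  rw [Finset.sum_const, Nat.card_Ioc, nsmul_eq_mul, show 2 * K - K = K by omega]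
  field_simp

lemma V_low_large (A : ℕ → ℝ) (c r δ : ℝ) (hc : 0 < c) (hr : 0 < r) (K n : ℕ) (hK : 1 ≤ K)
    (hKn : 16 * K ≤ n) (hδK : δ * (8 * K) ≤ 1) (hδ : 0 < δ)
    (hA : ∀ j : ℕ, 1 ≤ j → c * (j : ℝ) ^ (r - 1) * Real.exp (-(j * δ)) ≤ A j)
    (t : ℝ) (ht : Real.pi / (4 * K) ≤ |t|) (ht' : |t| ≤ Real.pi) :
    c * (Real.exp (-2) / 16) * 4 * (K : ℝ) ^ r ≤
      ∑ j ∈ Finset.Icc 1 n, A j * (1 - Real.cos (j * t)) := by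
  have hK0 : (0 : ℝ) < K := by exact_mod_cast hK
  have hA0 : ∀ j : ℕ, 1 ≤ j → 0 ≤ A j := fun j hj => le_trans (by positivity) (hA j hj)
  have hsub : Finset.Ioc (8 * K) (8 * K + 8 * K) ⊆ Finset.Icc 1 n := by
    intro j hj
    simp only [Finset.mem_Ioc, Finset.mem_Icc] at hj ⊢
    omega
  have h1 : ∑ j ∈ Finset.Ioc (8 * K) (8 * K + 8 * K), A j * (1 - Real.cos (j * t)) ≤
      ∑ j ∈ Finset.Icc 1 n, A j * (1 - Real.cos (j * t)) := by
    refine Finset.sum_le_sum_of_subset_of_nonneg hsub fun j hj _ => ?_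
    have := hA0 j (Finset.mem_Icc.1 hj).1
    have : 0 ≤ 1 - Real.cos (j * t) := by linarith [Real.cos_le_one (j * t)]
    positivity
  refine le_trans ?_ h1
  have h2 : ∑ j ∈ Finset.Ioc (8 * K) (8 * K + 8 * K), (c * (Real.exp (-2) / 16) * ((K : ℝ) ^ r / K)) *
      (1 - Real.cos (j * t)) ≤ ∑ j ∈ Finset.Ioc (8 * K) (8 * K + 8 * K), A j * (1 - Real.cos (j * t)) := by
    refine Finset.sum_le_sum fun j hj => ?_
    rw [Finset.mem_Ioc] at hj
    have hw := (weight_low c r δ hc hr K hK hδK hδ j (by omega) (by omega)).trans (hA j (by omega))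
    have : 0 ≤ 1 - Real.cos (j * t) := by linarith [Real.cos_le_one (j * t)]
    gcongr
  refine le_trans ?_ h2
  rw [← Finset.mul_sum, Finset.sum_sub_distrib, Finset.sum_const, Nat.card_Ioc, nsmul_eq_mul,
    show 8 * K + 8 * K - 8 * K = 8 * K by omega]
  have hs := sum_cos_le t (8 * K) (8 * K)
  have hsin : 1 / (4 * K) ≤ |Real.sin (t / 2)| := by
    have := Real.mul_abs_le_abs_sin (x := t / 2) (by rw [abs_div, abs_two]; linarith)
    refine le_trans ?_ this
    rw [abs_div, abs_two]
    calc 1 / (4 * (K : ℝ)) = 2 / Real.pi * ((Real.pi / (4 * K)) / 2) := by field_simp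
      _ ≤ _ := by gcongr
  have hS : ∑ j ∈ Finset.Ioc (8 * K) (8 * K + 8 * K), Real.cos (j * t) ≤ 4 * K := by
    set S := ∑ j ∈ Finset.Ioc (8 * K) (8 * K + 8 * K), Real.cos (j * t)
    rcases le_total S 0 with h | h
    · exact h.trans (by positivity)
    · have : 1 / (4 * K) * S ≤ 1 := le_trans (by gcongr) hs
      rw [div_mul_eq_mul_div, div_le_one (by positivity)] at this
      linarith
  calc _ = (c * (Real.exp (-2) / 16) * ((K : ℝ) ^ r / K)) * (8 * K - 4 * K) := by field_simp; norm_num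
    _ ≤ _ := by
      push_cast
      refine mul_le_mul_of_nonneg_left ?_ (by positivity)
      linarith

lemma B_low (A : ℕ → ℝ) (c r δ : ℝ) (hc : 0 < c) (hr : 0 < r) (K n : ℕ) (hK : 1 ≤ K)
    (hKn : 16 * K ≤ n) (hδK : δ * (8 * K) ≤ 1) (hδ : 0 < δ)
    (hA : ∀ j : ℕ, 1 ≤ j → c * (j : ℝ) ^ (r - 1) * Real.exp (-(j * δ)) ≤ A j) :
    c * (Real.exp (-2) / 16) * ((K : ℝ) ^ r * (K : ℝ) ^ 2) ≤
      ∑ j ∈ Finset.Icc 1 n, (j : ℝ) ^ 2 * A j := by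
  have hK0 : (0 : ℝ) < K := by exact_mod_cast hK
  have hA0 : ∀ j : ℕ, 1 ≤ j → 0 ≤ A j := fun j hj => le_trans (by positivity) (hA j hj)
  have hsub : Finset.Ioc K (2 * K) ⊆ Finset.Icc 1 n := by
    intro j hj
    simp only [Finset.mem_Ioc, Finset.mem_Icc] at hj ⊢
    omega
  have h1 : ∑ j ∈ Finset.Ioc K (2 * K), (j : ℝ) ^ 2 * A j ≤
      ∑ j ∈ Finset.Icc 1 n, (j : ℝ) ^ 2 * A j := by
    refine Finset.sum_le_sum_of_subset_of_nonneg hsub fun j hj _ => ?_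
    have := hA0 j (Finset.mem_Icc.1 hj).1
    positivity
  refine le_trans ?_ h1
  have h2 : ∑ j ∈ Finset.Ioc K (2 * K), (K : ℝ) ^ 2 * (c * (Real.exp (-2) / 16) * ((K : ℝ) ^ r / K))
      ≤ ∑ j ∈ Finset.Ioc K (2 * K), (j : ℝ) ^ 2 * A j := by
    refine Finset.sum_le_sum fun j hj => ?_
    rw [Finset.mem_Ioc] at hj
    have h1' : (K : ℝ) ≤ j := by exact_mod_cast hj.1.le
    have hw := (weight_low c r δ hc hr K hK hδK hδ j hj.1.le (by omega)).trans (hA j (by omega))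
    gcongr
  refine le_trans (le_of_eq ?_) h2
  rw [Finset.sum_const, Nat.card_Ioc, nsmul_eq_mul, show 2 * K - K = K by omega]
  field_simp

lemma moment_upper (r D : ℝ) (hr : 0 < r) (hD : 0 < D) (k : ℕ) (hk : 1 ≤ k) :
    ∃ C > 0, ∀ (A : ℕ → ℝ) (δ : ℝ) (K n : ℕ), 1 ≤ K → 0 < δ → 1 ≤ δ * (16 * K) →
      (∀ j : ℕ, 1 ≤ j → A j ≤ D * (j : ℝ) ^ (r - 1) * Real.exp (-(j * δ))) →
      ∑ j ∈ Finset.Icc 1 n, (j : ℝ) ^ k * A j ≤ C * ((K : ℝ) ^ r * (K : ℝ) ^ k) := by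
  have hk' : (1 : ℝ) ≤ k := by exact_mod_cast hk
  obtain ⟨C, hC, h⟩ := sum_upper (r - 1 + k) (by linarith)
  refine ⟨D * C * (16 : ℝ) ^ (r + k), by positivity, fun A δ K n hK hδ hδK hA => ?_⟩
  have hK0 : (0 : ℝ) < K := by exact_mod_cast hK
  have h1 : δ ^ (-(r - 1 + k + 1)) ≤ (16 : ℝ) ^ (r + k) * ((K : ℝ) ^ r * (K : ℝ) ^ k) := by
    rw [← Real.rpow_natCast (K : ℝ) k, ← Real.rpow_add hK0, ← Real.mul_rpow (by norm_num) hK0.le,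
      show -(r - 1 + k + 1) = -(r + k) by ring, Real.rpow_neg hδ.le, ← Real.inv_rpow hδ.le]
    refine Real.rpow_le_rpow (by positivity) ?_ (by positivity)
    rw [inv_le_iff_one_le_mul₀ hδ]
    linarith
  calc ∑ j ∈ Finset.Icc 1 n, (j : ℝ) ^ k * A j
      ≤ ∑ j ∈ Finset.Icc 1 n, D * ((j : ℝ) ^ (r - 1 + k) * Real.exp (-(j * δ))) := by
        refine Finset.sum_le_sum fun j hj => ?_
        have hj1 : 1 ≤ j := (Finset.mem_Icc.1 hj).1
        have hj0 : (0 : ℝ) < j := by exact_mod_cast hj1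
        rw [Real.rpow_add hj0, Real.rpow_natCast]
        calc (j : ℝ) ^ k * A j ≤ (j : ℝ) ^ k * (D * (j : ℝ) ^ (r - 1) * Real.exp (-(j * δ))) := by
              gcongr; exact hA j hj1
          _ = _ := by ring
    _ ≤ D * (C * δ ^ (-(r - 1 + k + 1))) := by
        rw [← Finset.mul_sum]; gcongr; exact h δ hδ n
    _ ≤ D * (C * ((16 : ℝ) ^ (r + k) * ((K : ℝ) ^ r * (K : ℝ) ^ k))) := by gcongr
    _ = _ := by ring

/-! ### The saddle point -/

lemma Mtilde_strictAnti (a : ℕ → ℕ) (ha : ∀ j, 1 ≤ j → 1 ≤ a j) (n : ℕ) (hn : 1 ≤ n) :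
    StrictAnti (Mtilde a n) := by
  intro s t hst
  unfold Mtilde
  refine Finset.sum_lt_sum_of_nonempty (Finset.nonempty_Icc.2 hn) fun j hj => ?_
  have hj1 : 1 ≤ j := (Finset.mem_Icc.1 hj).1
  have hj0 : (0 : ℝ) < j := by exact_mod_cast hj1
  have haj : (0 : ℝ) < a j := by exact_mod_cast ha j hj1
  have he : Real.exp (-(j * t)) < Real.exp (-(j * s)) := by
    apply Real.exp_lt_exp.2
    nlinarith
  have h1 := Real.exp_pos (-(j * t))
  have h2 := Real.exp_pos (-(j * s))
  rw [div_lt_div_iff₀ (by positivity) (by positivity)]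
  have : (0 : ℝ) < j * a j := by positivity
  nlinarith

lemma Mtilde_continuous (a : ℕ → ℕ) (n : ℕ) : Continuous (Mtilde a n) := by
  unfold Mtilde
  refine continuous_finsetSum _ fun j _ => ?_
  refine Continuous.div (by fun_prop) (by fun_prop) fun x => ?_
  have := Real.exp_pos (-(j * x))
  positivity

lemma existsUnique_saddle (a : ℕ → ℕ) (ha : ∀ j, 1 ≤ j → 1 ≤ a j) (n : ℕ) (hn : 4 ≤ n) :
    ∃! σ : ℝ, 0 < σ ∧ Mtilde a n σ = n := by
  have hanti := Mtilde_strictAnti a ha n (by omega)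
  have hn' : (4 : ℝ) ≤ n := by exact_mod_cast hn
  have h0 : (n : ℝ) < Mtilde a n 0 := by
    have h1 : ∑ j ∈ Finset.Icc 1 n, (j : ℝ) / 2 ≤ Mtilde a n 0 := by
      unfold Mtilde
      refine Finset.sum_le_sum fun j hj => ?_
      have hj1 : 1 ≤ j := (Finset.mem_Icc.1 hj).1
      have haj : (1 : ℝ) ≤ a j := by exact_mod_cast ha j hj1
      have hj0 : (0 : ℝ) < j := by exact_mod_cast hj1
      simp only [mul_zero, neg_zero, Real.exp_zero, mul_one]
      norm_num
      nlinarith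
    have h2 : ∀ m : ℕ, ∑ j ∈ Finset.Icc 1 m, (j : ℝ) / 2 = m * (m + 1) / 4 := by
      intro m
      induction m with
      | zero => simp
      | succ m ih => rw [Finset.sum_Icc_succ_top (by omega), ih]; push_cast; ring
    rw [h2] at h1
    nlinarith
  set T : ℝ := ∑ j ∈ Finset.Icc 1 n, (j : ℝ) * a j with hT
  have hT0 : 0 ≤ T := Finset.sum_nonneg fun _ _ => by positivity
  set S : ℝ := Real.log (1 + T) with hS
  have hS0 : 0 ≤ S := Real.log_nonneg (by linarith)
  have h1 : Mtilde a n S ≤ 1 := by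
    have : Mtilde a n S ≤ ∑ j ∈ Finset.Icc 1 n, (j : ℝ) * a j * Real.exp (-S) := by
      unfold Mtilde
      refine Finset.sum_le_sum fun j hj => ?_
      have hj1 : (1 : ℝ) ≤ j := by exact_mod_cast (Finset.mem_Icc.1 hj).1
      have h1 := Real.exp_pos (-(j * S))
      have h2 : Real.exp (-(j * S)) ≤ Real.exp (-S) := Real.exp_le_exp.2 (by nlinarith)
      refine (div_le_self (by positivity) (by linarith)).trans ?_
      gcongr
    refine this.trans ?_
    rw [← Finset.sum_mul, ← hT, Real.exp_neg, hS, Real.exp_log (by linarith), ← div_eq_mul_inv,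
      div_le_one (by linarith)]
    linarith
  obtain ⟨σ, hσ, hσM⟩ := intermediate_value_Icc' hS0 (Mtilde_continuous a n).continuousOn
    (show (n : ℝ) ∈ Set.Icc (Mtilde a n S) (Mtilde a n 0) from ⟨by linarith, h0.le⟩)
  refine ⟨σ, ⟨?_, hσM⟩, fun τ hτ => hanti.injective (hτ.2.trans hσM.symm)⟩
  rcases hσ.1.lt_or_eq with h | h
  · exact h
  · rw [← h] at hσM
    linarith

lemma pow_mul_exp_eq (y σ : ℝ) (hy : 1 ≤ y) (j : ℕ) :
    y ^ j * Real.exp (-(j * σ)) = Real.exp (-(j * (σ - Real.log y))) := by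
  have : y ^ j = Real.exp (j * Real.log y) := by
    rw [Real.exp_nat_mul, Real.exp_log (by linarith)]
  rw [this, ← Real.exp_add]
  congr 1
  ring

/-- The saddle point is close to `log y`. -/
lemma delta_tendsto (a : ℕ → ℕ) (r y D₁ D₂ : ℝ) (hr : 0 < r) (hy : 1 ≤ y) (hD₁ : 0 < D₁) (hD₂ : 0 < D₂)
    (h : ∀ j : ℕ, 1 ≤ j →
      D₁ * (j : ℝ) ^ (r - 1) * y ^ j ≤ (a j : ℝ) ∧ (a j : ℝ) ≤ D₂ * (j : ℝ) ^ (r - 1) * y ^ j)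
    (σ : ℕ → ℝ) (N : ℕ) (hσ : ∀ n ≥ N, 0 < σ n ∧ Mtilde a n (σ n) = n) :
    (∀ᶠ n : ℕ in atTop, 2 ≤ (σ n - Real.log y) * n) ∧
    ∀ ε > 0, ∀ᶠ n : ℕ in atTop, σ n - Real.log y < ε := by
  constructor
  · have hlim : Tendsto (fun n : ℕ => D₁ * (Real.exp (-2) / 2) * (1 / 2) * (1 / 2) ^ r * (n : ℝ) ^ r) atTop atTop := by
      refine Tendsto.const_mul_atTop (by positivity) ?_
      exact (tendsto_rpow_atTop hr).comp tendsto_natCast_atTop_atTop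
    filter_upwards [eventually_ge_atTop N, hlim.eventually_gt_atTop 1, eventually_ge_atTop 1] with n hn hbig hn1
    by_contra hcon
    push Not at hcon
    obtain ⟨hσ0, hM⟩ := hσ n hn
    have hn0 : (0 : ℝ) < n := by exact_mod_cast hn1
    set δ := σ n - Real.log y with hδ
    have hterm : ∀ j ∈ Finset.Icc 1 n, D₁ * (Real.exp (-2) / 2) * (j : ℝ) ^ r ≤
        (j : ℝ) * (a j) * Real.exp (-(j * σ n)) / (1 + Real.exp (-(j * σ n))) := by
      intro j hj
      have hj1 := (Finset.mem_Icc.1 hj).1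
      have hj0 : (0 : ℝ) < j := by exact_mod_cast hj1
      have hjn : (j : ℝ) ≤ n := by exact_mod_cast (Finset.mem_Icc.1 hj).2
      have he1 : Real.exp (-(j * σ n)) ≤ 1 := by
        rw [Real.exp_le_one_iff]; nlinarith
      have he0 := Real.exp_pos (-(j * σ n))
      have h1 : D₁ * (j : ℝ) ^ (r - 1) * Real.exp (-(j * δ)) ≤ a j * Real.exp (-(j * σ n)) := by
        rw [hδ, ← pow_mul_exp_eq y (σ n) hy j, ← mul_assoc]
        have := (h j hj1).1
        gcongr
      have h2 : Real.exp (-2) ≤ Real.exp (-(j * δ)) := by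
        apply Real.exp_le_exp.2
        have : δ * j ≤ 2 := by
          rcases le_total δ 0 with hd | hd
          · nlinarith
          · nlinarith
        linarith
      have e1 : (j : ℝ) ^ r = j * (j : ℝ) ^ (r - 1) := by
        rw [Real.rpow_sub_one hj0.ne']; field_simp
      rw [le_div_iff₀ (by positivity)]
      calc D₁ * (Real.exp (-2) / 2) * (j : ℝ) ^ r * (1 + Real.exp (-(j * σ n)))
          ≤ D₁ * (Real.exp (-2) / 2) * (j : ℝ) ^ r * (1 + 1) := by gcongr
        _ = j * (D₁ * (j : ℝ) ^ (r - 1) * Real.exp (-2)) := by rw [e1]; ring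
        _ ≤ j * (D₁ * (j : ℝ) ^ (r - 1) * Real.exp (-(j * δ))) := by gcongr
        _ ≤ j * (a j * Real.exp (-(j * σ n))) := by gcongr
        _ = _ := by ring
    have hsum : D₁ * (Real.exp (-2) / 2) * ∑ j ∈ Finset.Icc 1 n, (j : ℝ) ^ r ≤ n := by
      rw [← hM, Finset.mul_sum]
      exact Finset.sum_le_sum hterm
    have hlow : (n : ℝ) * (1 / 2) * ((1 / 2) ^ r * (n : ℝ) ^ r) ≤ ∑ j ∈ Finset.Icc 1 n, (j : ℝ) ^ r := by
      have hs : Finset.Ioc (n / 2) n ⊆ Finset.Icc 1 n := by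
        intro j hj
        simp only [Finset.mem_Ioc, Finset.mem_Icc] at hj ⊢
        omega
      refine le_trans ?_ (Finset.sum_le_sum_of_subset_of_nonneg hs fun j _ _ => by positivity)
      have : ∑ j ∈ Finset.Ioc (n / 2) n, ((1 / 2) ^ r * (n : ℝ) ^ r) ≤ ∑ j ∈ Finset.Ioc (n / 2) n, (j : ℝ) ^ r := by
        refine Finset.sum_le_sum fun j hj => ?_
        rw [← Real.mul_rpow (by norm_num) hn0.le]
        refine Real.rpow_le_rpow (by positivity) ?_ hr.le
        have : n ≤ 2 * j := by
          have := (Finset.mem_Ioc.1 hj).1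
          omega
        have : (n : ℝ) ≤ 2 * j := by exact_mod_cast this
        linarith
      refine le_trans ?_ this
      rw [Finset.sum_const, Nat.card_Ioc, nsmul_eq_mul]
      have : n ≤ 2 * (n - n / 2) := by omega
      have : (n : ℝ) ≤ 2 * ((n - n / 2 : ℕ) : ℝ) := by exact_mod_cast this
      refine mul_le_mul_of_nonneg_right ?_ (by positivity)
      linarith
    have hfin : (n : ℝ) * (D₁ * (Real.exp (-2) / 2) * (1 / 2) * (1 / 2) ^ r * (n : ℝ) ^ r) ≤ n := by
      refine le_trans (le_trans (le_of_eq ?_) (mul_le_mul_of_nonneg_left hlow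
        (by positivity : 0 ≤ D₁ * (Real.exp (-2) / 2)))) hsum
      ring
    nlinarith
  · intro ε hε
    obtain ⟨C, hC, hsum⟩ := sum_upper r hr
    filter_upwards [eventually_ge_atTop N,
      tendsto_natCast_atTop_atTop.eventually_gt_atTop (D₂ * (C * ε ^ (-(r + 1))))] with n hn hbig
    by_contra hcon
    push Not at hcon
    obtain ⟨hσ0, hM⟩ := hσ n hn
    have hup : Mtilde a n (σ n) ≤ D₂ * (C * ε ^ (-(r + 1))) := by
      refine le_trans ?_ (mul_le_mul_of_nonneg_left (hsum ε hε n) hD₂.le)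
      rw [Finset.mul_sum]
      unfold Mtilde
      refine Finset.sum_le_sum fun j hj => ?_
      have hj1 := (Finset.mem_Icc.1 hj).1
      have hj0 : (0 : ℝ) < j := by exact_mod_cast hj1
      have he0 := Real.exp_pos (-(j * σ n))
      refine (div_le_self (by positivity) (by linarith)).trans ?_
      have e1 : (j : ℝ) ^ r = j * (j : ℝ) ^ (r - 1) := by
        rw [Real.rpow_sub_one hj0.ne']; field_simp
      calc (j : ℝ) * a j * Real.exp (-(j * σ n))
          ≤ j * (D₂ * (j : ℝ) ^ (r - 1) * y ^ j) * Real.exp (-(j * σ n)) := by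
            have := (h j hj1).2
            gcongr
        _ = D₂ * ((j : ℝ) ^ r * (y ^ j * Real.exp (-(j * σ n)))) := by rw [e1]; ring
        _ ≤ _ := by
          rw [pow_mul_exp_eq y _ hy]
          gcongr
    linarith

lemma exists_scale (δ : ℕ → ℝ) (h1 : ∀ᶠ n : ℕ in atTop, 2 ≤ δ n * n)
    (h2 : ∀ ε > 0, ∀ᶠ n : ℕ in atTop, δ n < ε) :
    ∃ K : ℕ → ℕ, Tendsto K atTop atTop ∧ ∀ᶠ n in atTop,
      1 ≤ K n ∧ 16 * K n ≤ n ∧ 0 < δ n ∧ δ n * (8 * K n) ≤ 1 ∧ 1 ≤ δ n * (16 * K n) := by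
  have hpos : ∀ᶠ n : ℕ in atTop, 0 < δ n := by
    filter_upwards [h1] with n hn
    by_contra hc
    push Not at hc
    have : (0 : ℝ) ≤ n := by positivity
    nlinarith
  refine ⟨fun n => ⌊1 / (8 * δ n)⌋₊, ?_, ?_⟩
  · rw [tendsto_atTop]
    intro b
    filter_upwards [hpos, h2 (1 / (8 * (b + 1))) (by positivity)] with n hn hb
    apply Nat.le_floor
    rw [lt_div_iff₀ (by positivity)] at hb
    rw [le_div_iff₀ (by positivity)]
    nlinarith
  · filter_upwards [hpos, h1, h2 (1 / 16) (by norm_num)] with n hn hn1 hn2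
    have hfl : (⌊1 / (8 * δ n)⌋₊ : ℝ) ≤ 1 / (8 * δ n) := Nat.floor_le (by positivity)
    have hfl2 : 1 / (8 * δ n) < ⌊1 / (8 * δ n)⌋₊ + 1 := Nat.lt_floor_add_one _
    rw [le_div_iff₀ (by positivity)] at hfl
    rw [div_lt_iff₀ (by positivity)] at hfl2
    have hK : 1 ≤ ⌊1 / (8 * δ n)⌋₊ := by
      apply Nat.le_floor
      rw [le_div_iff₀ (by positivity)]
      push_cast
      linarith
    refine ⟨hK, ?_, hn, by linarith, by nlinarith⟩
    have : (16 : ℝ) * ⌊1 / (8 * δ n)⌋₊ ≤ n := by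
      have h3 : (16 : ℝ) * ⌊1 / (8 * δ n)⌋₊ * δ n ≤ n * δ n := by linarith
      exact le_of_mul_le_mul_right h3 hn
    exact_mod_cast this

/-! ### The local limit theorem -/

lemma third_ratio (c X K B : ℝ) (hc : 0 < c) (hX : 0 < X) (hK : 0 < K) (hB : 0 < B)
    (h : c * (X * K ^ 2) ≤ B ^ 2) : X * K ^ 3 / B ^ 3 ≤ Real.sqrt (1 / (c ^ 3 * X)) := by
  apply Real.le_sqrt_of_sq_le
  rw [div_pow, div_le_div_iff₀ (by positivity) (by positivity)]
  have h3 : (c * (X * K ^ 2)) ^ 3 ≤ (B ^ 2) ^ 3 := by gcongr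
  calc (X * K ^ 3) ^ 2 * (c ^ 3 * X) = (c * (X * K ^ 2)) ^ 3 := by ring
    _ ≤ _ := h3
    _ = _ := by ring

lemma fourth_ratio (c X K B : ℝ) (hc : 0 < c) (hX : 0 < X) (hK : 0 < K) (hB : 0 < B)
    (h : c * (X * K ^ 2) ≤ B ^ 2) : X * K ^ 4 / B ^ 4 ≤ 1 / (c ^ 2 * X) := by
  rw [div_le_div_iff₀ (by positivity) (by positivity)]
  have h3 : (c * (X * K ^ 2)) ^ 2 ≤ (B ^ 2) ^ 2 := by gcongr
  calc (X * K ^ 4) * (c ^ 2 * X) = (c * (X * K ^ 2)) ^ 2 := by ring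
    _ ≤ _ := h3
    _ = _ := by ring

lemma tail_eventually (r b C : ℝ) (hr : 0 < r) (hb : 0 < b) (K : ℕ → ℕ)
    (hK : Tendsto K atTop atTop) :
    ∀ᶠ n in atTop, Real.exp (-(b * (K n : ℝ) ^ r)) * (1 + C * ((K n : ℝ) ^ r * (K n : ℝ) ^ 2)) ≤ 1 := by
  have hX : Tendsto (fun n => (K n : ℝ) ^ r) atTop atTop :=
    (tendsto_rpow_atTop hr).comp (tendsto_natCast_atTop_atTop.comp hK)
  have h1 := (tendsto_rpow_mul_exp_neg_mul_atTop_nhds_zero (1 + 2 / r) b hb).comp hX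
  have h0 := (tendsto_rpow_mul_exp_neg_mul_atTop_nhds_zero 0 b hb).comp hX
  have h2 := h0.add (h1.const_mul C)
  simp only [mul_zero, add_zero] at h2
  filter_upwards [h2.eventually_lt_const (show (0 : ℝ) < 1 by norm_num), hK.eventually_ge_atTop 1] with n hn hK1
  have hK0 : (0 : ℝ) < K n := by exact_mod_cast hK1
  have e : ((K n : ℝ) ^ r) ^ (1 + 2 / r) = (K n : ℝ) ^ r * (K n : ℝ) ^ 2 := by
    rw [← Real.rpow_mul hK0.le, ← Real.rpow_natCast (K n : ℝ) 2, ← Real.rpow_add hK0]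
    congr 1
    push_cast
    field_simp
  simp only [Function.comp, Real.rpow_zero, one_mul, e] at hn
  rw [neg_mul] at hn
  linarith

lemma PhiSel_continuous (a : ℕ → ℕ) (n : ℕ) (σ : ℝ) : Continuous (PhiSel a n σ) := by
  unfold PhiSel
  fun_prop

lemma local_limit (a : ℕ → ℕ) (r y D₁ D₂ : ℝ) (hr : 0 < r) (hy : 1 ≤ y) (hD₁ : 0 < D₁) (hD₂ : 0 < D₂)
    (h : ∀ j : ℕ, 1 ≤ j →
      D₁ * (j : ℝ) ^ (r - 1) * y ^ j ≤ (a j : ℝ) ∧ (a j : ℝ) ≤ D₂ * (j : ℝ) ^ (r - 1) * y ^ j)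
    (σ : ℕ → ℝ) (N : ℕ) (hσ : ∀ n ≥ N, 0 < σ n ∧ Mtilde a n (σ n) = n) :
    (∀ᶠ n in atTop, 0 < B2tilde a n (σ n)) ∧
    Tendsto (fun n => (Real.sqrt (B2tilde a n (σ n)) : ℂ) *
      ∫ t in (-Real.pi)..Real.pi, PhiSel a n (σ n) t) atTop (nhds ((Real.sqrt (2 * Real.pi) : ℝ) : ℂ)) := by
  obtain ⟨hd1, hd2⟩ := delta_tendsto a r y D₁ D₂ hr hy hD₁ hD₂ h σ N hσ
  obtain ⟨K, hKtop, hK⟩ := exists_scale (fun n => σ n - Real.log y) hd1 hd2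
  set A : ℕ → ℕ → ℝ := fun n j =>
    (a j : ℝ) * (Real.exp (-(j * σ n)) / (1 + Real.exp (-(j * σ n))) ^ 2) with hA
  have hA0 : ∀ n j, 0 ≤ A n j := fun n j => by
    have := Real.exp_pos (-(j * σ n))
    simp only [hA]
    positivity
  have hAup : ∀ n, ∀ j : ℕ, 1 ≤ j →
      A n j ≤ D₂ * (j : ℝ) ^ (r - 1) * Real.exp (-(j * (σ n - Real.log y))) := by
    intro n j hj
    rw [← pow_mul_exp_eq y _ hy, ← mul_assoc]
    have h1 := Real.exp_pos (-(j * σ n))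
    have h2 : Real.exp (-(j * σ n)) / (1 + Real.exp (-(j * σ n))) ^ 2 ≤ Real.exp (-(j * σ n)) :=
      div_le_self h1.le (by nlinarith)
    have h3 := (h j hj).2
    simp only [hA]
    gcongr
  have hAlow : ∀ n ≥ N, ∀ j : ℕ, 1 ≤ j →
      D₁ / 4 * (j : ℝ) ^ (r - 1) * Real.exp (-(j * (σ n - Real.log y))) ≤ A n j := by
    intro n hn j hj
    rw [← pow_mul_exp_eq y _ hy]
    have h1 := Real.exp_pos (-(j * σ n))
    have hj0 : (0 : ℝ) < j := by exact_mod_cast hj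
    have h2 : Real.exp (-(j * σ n)) ≤ 1 := by
      rw [Real.exp_le_one_iff]
      have := (hσ n hn).1
      simp only [Left.neg_nonpos_iff]
      positivity
    have h3 := (h j hj).1
    have h4 : Real.exp (-(j * σ n)) / 4 ≤ Real.exp (-(j * σ n)) / (1 + Real.exp (-(j * σ n))) ^ 2 := by
      gcongr
      nlinarith
    simp only [hA]
    calc _ = (D₁ * (j : ℝ) ^ (r - 1) * y ^ j) * (Real.exp (-(j * σ n)) / 4) := by ring
      _ ≤ _ := by gcongr
  have hB2 : ∀ n, B2tilde a n (σ n) = ∑ j ∈ Finset.Icc 1 n, (j : ℝ) ^ 2 * A n j := by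
    intro n
    unfold B2tilde
    refine Finset.sum_congr rfl fun j _ => ?_
    simp only [hA]
    ring
  obtain ⟨C2, hC2, hm2⟩ := moment_upper r D₂ hr hD₂ 2 (by norm_num)
  obtain ⟨C3, hC3, hm3⟩ := moment_upper r D₂ hr hD₂ 3 (by norm_num)
  obtain ⟨C4, hC4, hm4⟩ := moment_upper r D₂ hr hD₂ 4 (by norm_num)
  set c0 : ℝ := D₁ / 4 * (Real.exp (-2) / 16) with hc0
  have hc0p : 0 < c0 := by have := Real.exp_pos (-2); positivity
  set B : ℕ → ℝ := fun n => Real.sqrt (B2tilde a n (σ n)) with hBdef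
  set X : ℕ → ℝ := fun n => (K n : ℝ) ^ r with hX
  have hXtop : Tendsto X atTop atTop :=
    (tendsto_rpow_atTop hr).comp (tendsto_natCast_atTop_atTop.comp hKtop)
  -- variance bounds
  have hB : ∀ᶠ n in atTop, 0 < B2tilde a n (σ n) ∧ 0 < B n ∧ B n ^ 2 = B2tilde a n (σ n) ∧
      c0 * (X n * (K n : ℝ) ^ 2) ≤ B n ^ 2 ∧ B n ^ 2 ≤ C2 * (X n * (K n : ℝ) ^ 2) := by
    filter_upwards [hK, eventually_ge_atTop N] with n ⟨k1, k2, k3, k4, k5⟩ hn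
    have hK0 : (0 : ℝ) < K n := by exact_mod_cast k1
    have l1 := B_low (A n) (D₁ / 4) r (σ n - Real.log y) (by positivity) hr (K n) n k1 k2 k4 k3 (hAlow n hn)
    have l2 := hm2 (A n) (σ n - Real.log y) (K n) n k1 k3 k5 (hAup n)
    rw [← hB2] at l1 l2
    have hpos : 0 < B2tilde a n (σ n) := lt_of_lt_of_le (by positivity) l1
    have hsq : B n ^ 2 = B2tilde a n (σ n) := Real.sq_sqrt hpos.le
    exact ⟨hpos, Real.sqrt_pos.2 hpos, hsq, by rw [hsq]; exact l1, by rw [hsq]; exact l2⟩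
  refine ⟨hB.mono fun n hn => hn.1, ?_⟩
  set F : ℕ → ℝ → ℂ := fun n => Set.indicator (Set.Ioc (-Real.pi * B n) (Real.pi * B n))
    (fun s => PhiSel a n (σ n) (s / B n)) with hF
  have hFint : ∀ᶠ n in atTop, (∫ s, F n s) = (Real.sqrt (B2tilde a n (σ n)) : ℂ) *
      ∫ t in (-Real.pi)..Real.pi, PhiSel a n (σ n) t := by
    filter_upwards [hB] with n ⟨_, b2, _, _, _⟩
    simp only [hF]
    rw [MeasureTheory.integral_indicator measurableSet_Ioc,
      ← intervalIntegral.integral_of_le (by nlinarith [Real.pi_pos]),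
      intervalIntegral.integral_comp_div _ b2.ne', mul_div_cancel_right₀ _ b2.ne',
      mul_div_cancel_right₀ _ b2.ne', Complex.real_smul]
  set c1 : ℝ := c0 * (2 / Real.pi ^ 2) / C2 with hc1
  have hc1p : 0 < c1 := by have := Real.pi_pos; positivity
  have hbound : ∀ᶠ n in atTop, ∀ᵐ s : ℝ, ‖F n s‖ ≤ Real.exp (-c1 * s ^ 2) + (1 + s ^ 2)⁻¹ := by
    filter_upwards [hB, hK, eventually_ge_atTop N,
      tail_eventually r (c0 * 4) (Real.pi ^ 2 * C2) hr (by positivity) K hKtop]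
      with n ⟨b1, b2, b3, b4, b5⟩ ⟨k1, k2, k3, k4, k5⟩ hn htail
    refine Filter.Eventually.of_forall fun s => ?_
    have hK0 : (0 : ℝ) < K n := by exact_mod_cast k1
    have hX0 : 0 < X n := by positivity
    have hpi := Real.pi_pos
    by_cases hs : s ∈ Set.Ioc (-Real.pi * B n) (Real.pi * B n)
    · simp only [hF]
      rw [Set.indicator_of_mem hs]
      have hsB : |s| ≤ Real.pi * B n := abs_le.2 ⟨by linarith [hs.1], hs.2⟩
      have htpi : |s / B n| ≤ Real.pi := by
        rw [abs_div, abs_of_pos b2, div_le_iff₀ b2]; exact hsB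
      refine (norm_PhiSel_le a n (σ n) (s / B n)).trans ?_
      rcases le_total |s / B n| (Real.pi / (4 * K n)) with ht | ht
      · have hv := V_low_small (A n) (D₁ / 4) r (σ n - Real.log y) (by positivity) hr (K n) n k1 k2 k4 k3
          (hAlow n hn) (s / B n) ht
        have : c1 * s ^ 2 ≤ c0 * (2 / Real.pi ^ 2) * (X n * (K n : ℝ) ^ 2) * (s / B n) ^ 2 := by
          have e : c0 * (2 / Real.pi ^ 2) * (X n * (K n : ℝ) ^ 2) * (s / B n) ^ 2
              = (c1 * s ^ 2 * (C2 * (X n * (K n : ℝ) ^ 2))) / B n ^ 2 := by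
            rw [hc1]; field_simp
          rw [e, le_div_iff₀ (by positivity)]
          gcongr
        have h2 : (0 : ℝ) ≤ (1 + s ^ 2)⁻¹ := by positivity
        have h3 : Real.exp (-∑ j ∈ Finset.Icc 1 n, A n j * (1 - Real.cos (j * (s / B n))))
            ≤ Real.exp (-c1 * s ^ 2) := by
          apply Real.exp_le_exp.2
          rw [neg_mul]
          exact neg_le_neg (this.trans hv)
        exact h3.trans (by linarith)
      · have hv := V_low_large (A n) (D₁ / 4) r (σ n - Real.log y) (by positivity) hr (K n) n k1 k2 k4 k3
          (hAlow n hn) (s / B n) ht htpi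
        have h3 : Real.exp (-∑ j ∈ Finset.Icc 1 n, A n j * (1 - Real.cos (j * (s / B n))))
            ≤ Real.exp (-(c0 * 4 * X n)) := by
          apply Real.exp_le_exp.2
          exact neg_le_neg hv
        have h4 : Real.exp (-(c0 * 4 * X n)) ≤ (1 + s ^ 2)⁻¹ := by
          rw [← one_div, le_div_iff₀ (by positivity)]
          refine le_trans ?_ htail
          have : s ^ 2 ≤ Real.pi ^ 2 * C2 * (X n * (K n : ℝ) ^ 2) := by
            calc s ^ 2 = |s| ^ 2 := (sq_abs s).symm
              _ ≤ (Real.pi * B n) ^ 2 := by gcongr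
              _ = Real.pi ^ 2 * B n ^ 2 := by ring
              _ ≤ Real.pi ^ 2 * (C2 * (X n * (K n : ℝ) ^ 2)) := by gcongr
              _ = _ := by ring
          gcongr
        have h5 := Real.exp_pos (-c1 * s ^ 2)
        exact h3.trans (by linarith)
    · simp only [hF]
      rw [Set.indicator_of_notMem hs, norm_zero]
      positivity
  have hlim : ∀ᵐ s : ℝ, Tendsto (fun n => F n s) atTop (nhds ((Real.exp (-(1 / 2) * s ^ 2) : ℝ) : ℂ)) := by
    refine Filter.Eventually.of_forall fun s => ?_
    have hBtop : ∀ᶠ n in atTop, s ∈ Set.Ioc (-Real.pi * B n) (Real.pi * B n) := by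
      filter_upwards [hB, hK, hXtop.eventually_gt_atTop (s ^ 2 / c0)] with n ⟨b1, b2, b3, b4, b5⟩ ⟨k1, _⟩ hx
      have hK1 : (1 : ℝ) ≤ K n := by exact_mod_cast k1
      rw [div_lt_iff₀ hc0p] at hx
      have hX0 : 0 < X n := by positivity
      have h1 : s ^ 2 < B n ^ 2 := by
        have : X n * 1 ≤ X n * (K n : ℝ) ^ 2 := by gcongr; nlinarith
        nlinarith
      have h2 : |s| < B n := lt_of_pow_lt_pow_left₀ 2 b2.le (by rwa [sq_abs])
      have h3 := abs_lt.1 h2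
      have h4 := Real.pi_gt_three
      constructor <;> nlinarith
    have herr : Tendsto (fun n => 4 * |s| ^ 3 * C3 * Real.sqrt (1 / (c0 ^ 3 * X n))
        + |s| ^ 4 * C4 * (1 / (c0 ^ 2 * X n))) atTop (nhds 0) := by
      have e1 : Tendsto (fun n => 1 / (c0 ^ 3 * X n)) atTop (nhds 0) := by
        simp_rw [one_div]
        exact (hXtop.const_mul_atTop (by positivity)).inv_tendsto_atTop
      have e2 : Tendsto (fun n => 1 / (c0 ^ 2 * X n)) atTop (nhds 0) := by
        simp_rw [one_div]
        exact (hXtop.const_mul_atTop (by positivity)).inv_tendsto_atTop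
      have e3 := (Real.continuous_sqrt.tendsto 0).comp e1
      rw [Real.sqrt_zero] at e3
      simpa using (e3.const_mul (4 * |s| ^ 3 * C3)).add (e2.const_mul (|s| ^ 4 * C4))
    rw [tendsto_iff_norm_sub_tendsto_zero]
    refine squeeze_zero' (Filter.Eventually.of_forall fun _ => norm_nonneg _) ?_ herr
    filter_upwards [hBtop, hB, hK, eventually_ge_atTop N] with n hs ⟨b1, b2, b3, b4, b5⟩ ⟨k1, k2, k3, k4, k5⟩ hn
    have hK0 : (0 : ℝ) < K n := by exact_mod_cast k1
    have hX0 : 0 < X n := by positivity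
    simp only [hF]
    rw [Set.indicator_of_mem hs]
    have hp := norm_PhiSel_sub_le a n (σ n) (s / B n) (hσ n hn).2
    have e0 : -(B2tilde a n (σ n) * (s / B n) ^ 2 / 2) = -(1 / 2) * s ^ 2 := by
      rw [← b3]; field_simp
    rw [e0, ← Complex.ofReal_exp] at hp
    refine hp.trans ?_
    have l3 := hm3 (A n) (σ n - Real.log y) (K n) n k1 k3 k5 (hAup n)
    have l4 := hm4 (A n) (σ n - Real.log y) (K n) n k1 k3 k5 (hAup n)
    have e1 : ∑ j ∈ Finset.Icc 1 n, (a j : ℝ) * (Real.exp (-(j * σ n)) / (1 + Real.exp (-(j * σ n))) ^ 2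
        * (4 * |j * (s / B n)| ^ 3 + |j * (s / B n)| ^ 4))
        = 4 * |s| ^ 3 / B n ^ 3 * ∑ j ∈ Finset.Icc 1 n, (j : ℝ) ^ 3 * A n j
          + |s| ^ 4 / B n ^ 4 * ∑ j ∈ Finset.Icc 1 n, (j : ℝ) ^ 4 * A n j := by
      rw [Finset.mul_sum, Finset.mul_sum, ← Finset.sum_add_distrib]
      refine Finset.sum_congr rfl fun j _ => ?_
      simp only [hA]
      rw [abs_mul, abs_div, abs_of_pos b2, abs_of_nonneg (by positivity : (0 : ℝ) ≤ j)]
      ring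
    rw [e1]
    have r3 := third_ratio c0 (X n) (K n) (B n) hc0p hX0 hK0 b2 b4
    have r4 := fourth_ratio c0 (X n) (K n) (B n) hc0p hX0 hK0 b2 b4
    refine add_le_add ?_ ?_
    · calc _ ≤ 4 * |s| ^ 3 / B n ^ 3 * (C3 * (X n * (K n : ℝ) ^ 3)) := by gcongr
        _ = 4 * |s| ^ 3 * C3 * (X n * (K n : ℝ) ^ 3 / B n ^ 3) := by ring
        _ ≤ _ := by gcongr
    · calc _ ≤ |s| ^ 4 / B n ^ 4 * (C4 * (X n * (K n : ℝ) ^ 4)) := by gcongr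
        _ = |s| ^ 4 * C4 * (X n * (K n : ℝ) ^ 4 / B n ^ 4) := by ring
        _ ≤ _ := by gcongr
  have hmeas : ∀ᶠ n in atTop, MeasureTheory.AEStronglyMeasurable (F n) MeasureTheory.volume := by
    refine Filter.Eventually.of_forall fun n => ?_
    refine MeasureTheory.AEStronglyMeasurable.indicator ?_ measurableSet_Ioc
    exact ((PhiSel_continuous a n (σ n)).comp (continuous_id.div_const (B n))).aestronglyMeasurable
  have hdom_int : MeasureTheory.Integrable (fun s : ℝ => Real.exp (-c1 * s ^ 2) + (1 + s ^ 2)⁻¹) :=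
    (integrable_exp_neg_mul_sq hc1p).add integrable_inv_one_add_sq
  have hdct := MeasureTheory.tendsto_integral_filter_of_dominated_convergence
    (fun s : ℝ => Real.exp (-c1 * s ^ 2) + (1 + s ^ 2)⁻¹) hmeas hbound hdom_int hlim
  have hval : ∫ s : ℝ, ((Real.exp (-(1 / 2) * s ^ 2) : ℝ) : ℂ) = ((Real.sqrt (2 * Real.pi) : ℝ) : ℂ) := by
    rw [integral_complex_ofReal, integral_gaussian]
    congr 2
    field_simp
  rw [hval] at hdct
  exact hdct.congr' hFint


/-- selections: under condition (exp), for all sufficiently large `n` there is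
a unique `σ̃_n > 0` with `M̃_n(σ̃_n) = n`, and
`c̃_n ∼ (e^{nσ̃_n}/√(2π B̃_n²)) · Π_{j=1}^n (1 + e^{-jσ̃_n})^{a_j}`. -/
theorem selection_asymptotics (a : ℕ → ℕ) (r y : ℝ) (hr : 0 < r) (hy : 1 ≤ y)
    (hexp : ExpansiveCond a r y) :
    ∃ N : ℕ, (∀ n ≥ N, ∃! σ : ℝ, 0 < σ ∧ Mtilde a n σ = n) ∧
      ∀ σ : ℕ → ℝ, (∀ n ≥ N, 0 < σ n ∧ Mtilde a n (σ n) = n) →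
        Tendsto (fun n : ℕ =>
          (selectionCount a n : ℝ) /
            (Real.exp (n * σ n) / Real.sqrt (2 * Real.pi * B2tilde a n (σ n)) *
              ∏ j ∈ Finset.Icc 1 n, (1 + Real.exp (-(j * σ n))) ^ (a j)))
          atTop (nhds 1) := by
  obtain ⟨D₁, D₂, hD₁, hD₂, h⟩ := hexp
  have ha : ∀ j, 1 ≤ j → 1 ≤ a j := by
    intro j hj
    have hj0 : (0 : ℝ) < j := by exact_mod_cast hj
    have hy0 : 0 < y := by linarith
    have h1 : (0 : ℝ) < a j := lt_of_lt_of_le (by positivity) (h j hj).1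
    exact_mod_cast h1
  refine ⟨4, fun n hn => existsUnique_saddle a ha n hn, fun σ hσ => ?_⟩
  obtain ⟨hpos, hlim⟩ := local_limit a r y D₁ D₂ hr hy hD₁ hD₂ h σ 4 hσ
  simp_rw [integral_PhiSel, ← Complex.ofReal_mul] at hlim
  have hlim' := (Complex.continuous_re.tendsto _).comp hlim
  have h2pi : (0 : ℝ) < Real.sqrt (2 * Real.pi) := Real.sqrt_pos.2 (by positivity)
  have hfin := hlim'.div_const (Real.sqrt (2 * Real.pi))
  simp only [Complex.ofReal_re] at hfin
  rw [div_self h2pi.ne'] at hfin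
  refine hfin.congr' ?_
  filter_upwards [hpos] with n hn
  simp only [Function.comp, Complex.ofReal_re]
  have hB := Real.sqrt_pos.2 hn
  have hP : 0 < ∏ j ∈ Finset.Icc 1 n, (1 + Real.exp (-(j * σ n))) ^ (a j) :=
    Finset.prod_pos fun j _ => by positivity
  have hE := Real.exp_pos (n * σ n)
  rw [Real.sqrt_mul (by positivity) (B2tilde a n (σ n))]
  have hsq : Real.sqrt (2 * Real.pi) * Real.sqrt (2 * Real.pi) = 2 * Real.pi :=
    Real.mul_self_sqrt (by positivity)
  field_simp
  rw [sq, hsq]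
  ring
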